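/- Let l ≥ 1 be an integer, let {m_k} be an enumeration of the integers of D(l), and let T = {t_{n,k}} be a summation method satisfying: for each n the family {t_{n,k} : k} has finitely many nonzero entries, |t_{n,k}| ≤ M for all n,k, and lim_{n→∞} t_{n,k} = 1 for each k. If real coefficients {a_k} are such that the sums ∑_k t_{n,k} a_k w_{m_k}(x) converge to zero as n → ∞ for every x in a measurable set E ⊂ (0,1) of measure |E| > 1 − 2^{−l}, then a_k = 0 for all k. -/

import Mathlib

open MeasureTheory Filter Finset Topology

noncomputable section

/-- Rademacher function `r_n(x) = sign (sin (2^n π x))`. -/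
def rademacher (n : ℕ) (x : ℝ) : ℝ := Real.sign (Real.sin (2 ^ n * Real.pi * x))

/-- Walsh function: for `m = 2^{k₁} + ⋯ + 2^{k_s}` (binary representation),
`w_m(x) = r_{k₁}(x) ⋯ r_{k_s}(x)`. -/
def walsh (m : ℕ) (x : ℝ) : ℝ :=
  ∏ k ∈ Finset.range (m + 1), if m.testBit k then rademacher k x else 1

/-- `D(l)`: positive integers `m = 2^{k₁} + ⋯ + 2^{k_l}` with `k₁ > ⋯ > k_l ≥ 1`. -/
def DyadicSums (l : ℕ) : Set ℕ :=
  {m | ∃ k : Fin l → ℕ, StrictAnti k ∧ (∀ j, 1 ≤ k j) ∧ m = ∑ j, 2 ^ (k j)}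

/-- Positions of the binary ones. -/
def bitSet (n : ℕ) : Finset ℕ := n.bitIndices.toFinset

/-- Non-dyadic reals. -/
def nonDyadic : Set ℝ := {x | ∀ (k : ℕ) (n : ℤ), 2 ^ k * x ≠ n}

/-- Flip of the `k`-th binary digit. -/
def dflip (k : ℕ) (x : ℝ) : ℝ := x + rademacher k x / 2 ^ k

theorem walsh_eq (n : ℕ) (x : ℝ) : walsh n x = ∏ k ∈ bitSet n, rademacher k x := by
  unfold walsh
  rw [← Finset.prod_filter]
  apply Finset.prod_congr _ (fun _ _ => rfl)
  ext k
  simp only [Finset.mem_filter, Finset.mem_range, bitSet, List.mem_toFinset, Nat.mem_bitIndices,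
    and_iff_right_iff_imp]
  intro h
  have := Nat.two_pow_le_of_mem_bitIndices (Nat.mem_bitIndices.2 h)
  have := Nat.lt_two_pow_self (n := k)
  omega

theorem bitSet_inj {a b : ℕ} (h : bitSet a = bitSet b) : a = b := by
  rw [← Finset.sum_toFinset_bitIndices_two_pow a, ← Finset.sum_toFinset_bitIndices_two_pow b]
  unfold bitSet at h
  rw [h]

theorem bitSet_dyadic {l n : ℕ} (h : n ∈ DyadicSums l) :
    (bitSet n).card = l ∧ ∀ k ∈ bitSet n, 1 ≤ k := by
  obtain ⟨k, hk, hk1, rfl⟩ := h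
  have : ∑ j, 2 ^ (k j) = ∑ i ∈ Finset.univ.image k, 2 ^ i := by
    rw [Finset.sum_image (fun a _ b _ h => hk.injective h)]
  rw [this, bitSet, Finset.toFinset_bitIndices_sum_two_pow]
  refine ⟨by rw [Finset.card_image_of_injective _ hk.injective]; simp, ?_⟩
  simpa using hk1

theorem rad_eq {x : ℝ} (hx : x ∈ nonDyadic) (k : ℕ) :
    rademacher k x = (-1) ^ ⌊2 ^ k * x⌋ := by
  unfold rademacher
  set y := 2 ^ k * x with hy
  have h1 : 2 ^ k * Real.pi * x = Int.fract y * Real.pi + ⌊y⌋ * Real.pi := by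
    rw [← add_mul, Int.fract_add_floor, hy]; ring
  have h0 : 0 < Int.fract y := by
    refine lt_of_le_of_ne (Int.fract_nonneg y) (fun h => hx k ⌊y⌋ ?_)
    have := Int.fract_add_floor y
    rw [← h] at this
    linarith
  have hs : 0 < Real.sin (Int.fract y * Real.pi) := by
    apply Real.sin_pos_of_pos_of_lt_pi (by positivity)
    nlinarith [Int.fract_lt_one y, Real.pi_pos]
  rw [h1, Real.sin_add_int_mul_pi]
  rcases Int.even_or_odd ⌊y⌋ with h | h
  · rw [h.neg_one_zpow, one_mul, Real.sign_of_pos hs]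
  · rw [h.neg_one_zpow, Real.sign_of_neg (by linarith)]

theorem rad_pm {x : ℝ} (hx : x ∈ nonDyadic) (k : ℕ) :
    (rademacher k x = 1 ∧ Even ⌊2 ^ k * x⌋) ∨ (rademacher k x = -1 ∧ Odd ⌊2 ^ k * x⌋) := by
  rw [rad_eq hx]
  rcases Int.even_or_odd ⌊2 ^ k * x⌋ with h | h
  · left; exact ⟨h.neg_one_zpow, h⟩
  · right; exact ⟨h.neg_one_zpow, h⟩

theorem rad_int {x : ℝ} (hx : x ∈ nonDyadic) (k : ℕ) :
    ∃ e : ℤ, rademacher k x = e ∧ (e = 1 ∨ e = -1) ∧ (e = 1 ↔ Even ⌊2 ^ k * x⌋) := by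
  rcases rad_pm hx k with ⟨h, h'⟩ | ⟨h, h'⟩
  · exact ⟨1, by simp [h], by simp, by simp [h']⟩
  · exact ⟨-1, by simp [h], by simp, by simpa using h'⟩

theorem flip_mem {x : ℝ} (hx : x ∈ nonDyadic) (k : ℕ) : dflip k x ∈ nonDyadic := by
  intro j n h
  obtain ⟨e, he, -⟩ := rad_int hx k
  apply hx (j + k) (2 ^ k * n - 2 ^ j * e)
  unfold dflip at h
  rw [he] at h
  push_cast
  rw [← h]
  field_simp
  ring

theorem floor_flip {x : ℝ} (hx : x ∈ nonDyadic) {j k : ℕ} (hjk : j < k) :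
    ⌊2 ^ j * dflip k x⌋ = ⌊2 ^ j * x⌋ := by
  obtain ⟨e, he, he1, he2⟩ := rad_int hx k
  obtain ⟨d, rfl⟩ : ∃ d, k = j + (d + 1) := ⟨k - j - 1, by omega⟩
  have key : ∀ y : ℝ, ⌊2 ^ j * y⌋ = ⌊2 ^ (j + (d + 1)) * y⌋ / 2 / ((2 ^ d : ℕ) : ℤ) := by
    intro y
    rw [show (2 : ℝ) ^ j * y = 2 ^ (j + (d + 1)) * y / ((2 : ℕ) : ℝ) / ((2 ^ d : ℕ) : ℝ) by
      push_cast; field_simp; ring, Int.floor_div_natCast, Int.floor_div_natCast]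
    rfl
  rw [key, key]
  congr 1
  have : 2 ^ (j + (d + 1)) * dflip (j + (d + 1)) x = 2 ^ (j + (d + 1)) * x + e := by
    unfold dflip; rw [he]; field_simp
  rw [this, Int.floor_add_intCast]
  rw [Int.even_iff] at he2
  omega

theorem rad_flip_ne {x : ℝ} (hx : x ∈ nonDyadic) {j k : ℕ} (hjk : j ≠ k) :
    rademacher j (dflip k x) = rademacher j x := by
  rw [rad_eq hx, rad_eq (flip_mem hx k)]
  rcases lt_or_gt_of_ne hjk with h | h
  · rw [floor_flip hx h]
  · obtain ⟨e, he, -⟩ := rad_int hx k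
    obtain ⟨d, rfl⟩ : ∃ d, j = k + (d + 1) := ⟨j - k - 1, by omega⟩
    have : 2 ^ (k + (d + 1)) * dflip k x = 2 ^ (k + (d + 1)) * x + ((2 * (2 ^ d * e) : ℤ) : ℝ) := by
      unfold dflip; rw [he]; push_cast; field_simp; ring
    rw [this, Int.floor_add_intCast, zpow_add₀ (by norm_num), zpow_mul]
    simp

theorem rad_flip_self {x : ℝ} (hx : x ∈ nonDyadic) (k : ℕ) :
    rademacher k (dflip k x) = - rademacher k x := by
  obtain ⟨e, he, he1, -⟩ := rad_int hx k
  have : 2 ^ k * dflip k x = 2 ^ k * x + e := by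
    unfold dflip; rw [he]; field_simp
  rw [rad_eq hx, rad_eq (flip_mem hx k), this, Int.floor_add_intCast, zpow_add₀ (by norm_num)]
  rcases he1 with rfl | rfl <;> simp

theorem flip_mem_Ioo {x : ℝ} (hx : x ∈ nonDyadic) (h01 : x ∈ Set.Ioo (0 : ℝ) 1) {k : ℕ}
    (hk : 1 ≤ k) : dflip k x ∈ Set.Ioo (0 : ℝ) 1 := by
  have h := floor_flip hx (j := 0) (k := k) hk
  have h0 : ⌊x⌋ = 0 := Int.floor_eq_zero_iff.2 ⟨h01.1.le, h01.2⟩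
  simp only [pow_zero, one_mul, h0] at h
  have h2 := Int.floor_eq_zero_iff.1 h
  refine ⟨lt_of_le_of_ne h2.1 (fun h3 => flip_mem hx k 0 0 ?_), h2.2⟩
  simp [← h3]

theorem prod_flip {x : ℝ} (hx : x ∈ nonDyadic) (k : ℕ) (S : Finset ℕ) :
    ∏ j ∈ S, rademacher j (dflip k x) =
      if k ∈ S then - ∏ j ∈ S, rademacher j x else ∏ j ∈ S, rademacher j x := by
  split_ifs with h
  · rw [← Finset.mul_prod_erase S _ h, ← Finset.mul_prod_erase S (fun j => rademacher j x) h,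
      rad_flip_self hx, neg_mul]
    congr 2
    exact Finset.prod_congr rfl (fun j hj => rad_flip_ne hx (Finset.ne_of_mem_erase hj))
  · exact Finset.prod_congr rfl (fun j hj => rad_flip_ne hx (fun e => h (e ▸ hj)))

theorem measurable_rad (k : ℕ) : Measurable (rademacher k) := by
  have hs : Measurable (fun x : ℝ => Real.sin (2 ^ k * Real.pi * x)) := by fun_prop
  unfold rademacher Real.sign
  exact Measurable.ite (measurableSet_lt hs measurable_const) measurable_const
    (Measurable.ite (measurableSet_lt measurable_const hs) measurable_const measurable_const)

theorem measurable_flip (k : ℕ) : Measurable (dflip k) := by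
  have := measurable_rad k
  unfold dflip
  fun_prop

theorem ae_nonDyadic : volume (nonDyadicᶜ) = 0 := by
  have : nonDyadicᶜ ⊆ Set.range (fun p : ℕ × ℤ => (p.2 : ℝ) / 2 ^ p.1) := by
    intro x hx
    simp only [nonDyadic, Set.mem_compl_iff, Set.mem_ofPred_eq, not_forall, not_not] at hx
    obtain ⟨k, n, h⟩ := hx
    refine ⟨(k, n), ?_⟩
    simp only [← h]
    field_simp
  exact measure_mono_null this ((Set.countable_range _).measure_zero volume)

theorem volume_flip_le (k : ℕ) (B : Set ℝ) :
    volume (dflip k ⁻¹' B) ≤ volume B := by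
  set P : Set ℝ := {x | rademacher k x = 1} with hP
  have hPm : MeasurableSet P := measurable_rad k (measurableSet_singleton 1)
  have hsub : dflip k ⁻¹' B ⊆ nonDyadicᶜ ∪
      ((fun x => x + 1 / 2 ^ k) ⁻¹' (B \ P) ∪ (fun x => x + (-1 / 2 ^ k)) ⁻¹' (B ∩ P)) := by
    intro x hx
    by_cases hxd : x ∈ nonDyadic
    · right
      have hs := rad_flip_self hxd k
      have hx' : dflip k x ∈ B := hx
      rcases rad_pm hxd k with ⟨h, -⟩ | ⟨h, -⟩
      · left
        have e : dflip k x = x + 1 / 2 ^ k := by unfold dflip; rw [h]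
        rw [Set.mem_preimage, ← e]
        refine ⟨hx', ?_⟩
        rw [hP, Set.mem_ofPred_eq, hs, h]; norm_num
      · right
        have e : dflip k x = x + (-1 / 2 ^ k) := by unfold dflip; rw [h]
        rw [Set.mem_preimage, ← e]
        refine ⟨hx', ?_⟩
        rw [hP, Set.mem_ofPred_eq, hs, h]; norm_num
    · left; exact hxd
  calc volume (dflip k ⁻¹' B) ≤ _ := measure_mono hsub
    _ ≤ _ := measure_union_le _ _
    _ ≤ volume (nonDyadicᶜ) + (_ + _) := by gcongr; exact measure_union_le _ _
    _ = volume (B \ P) + volume (B ∩ P) := by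
      rw [ae_nonDyadic, zero_add, measure_preimage_add_right, measure_preimage_add_right]
    _ = volume B := by rw [add_comm, measure_inter_add_sdiff B hPm]

theorem main_induction (S : ℕ → Finset ℕ) (c : ℕ → ℕ → ℝ) (s : ℕ → Finset ℕ) (B : Set ℝ)
    (hB : MeasurableSet B)
    (hz : ∀ x ∈ nonDyadic ∩ Set.Ioo 0 1, x ∉ B →
      Tendsto (fun i => ∑ k ∈ s i, c i k * ∏ j ∈ S k, rademacher j x) atTop (𝓝 0))
    (U : Finset ℕ) (hU : ∀ u ∈ U, 1 ≤ u) :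
    ∃ B' : Set ℝ, MeasurableSet B' ∧ volume B' ≤ 2 ^ U.card * volume B ∧
      ∀ x ∈ nonDyadic ∩ Set.Ioo 0 1, x ∉ B' →
        Tendsto (fun i => ∑ k ∈ s i, if U ⊆ S k then c i k * ∏ j ∈ S k, rademacher j x else 0)
          atTop (𝓝 0) := by
  induction U using Finset.induction_on with
  | empty => exact ⟨B, hB, by simp, by simpa using hz⟩
  | insert u U hu ih =>
    obtain ⟨B', hB', hv, h⟩ := ih (fun v hv => hU v (Finset.mem_insert_of_mem hv))
    refine ⟨B' ∪ dflip u ⁻¹' B', hB'.union (measurable_flip u hB'), ?_, ?_⟩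
    · calc _ ≤ _ := measure_union_le _ _
        _ ≤ volume B' + volume B' := add_le_add le_rfl (volume_flip_le u B')
        _ ≤ 2 ^ U.card * volume B + 2 ^ U.card * volume B := by gcongr
        _ = _ := by rw [Finset.card_insert_of_notMem hu]; ring
    · intro x hx hxB
      have h1 := h x hx (fun h => hxB (Or.inl h))
      have h2 := h (dflip u x) ⟨flip_mem hx.1 u,
        flip_mem_Ioo hx.1 hx.2 (hU u (Finset.mem_insert_self _ _))⟩ (fun h => hxB (Or.inr h))
      have h3 := (h1.sub h2).div_const 2
      rw [sub_zero, zero_div] at h3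
      refine h3.congr (fun i => ?_)
      rw [← Finset.sum_sub_distrib, Finset.sum_div]
      refine Finset.sum_congr rfl (fun k _ => ?_)
      rw [prod_flip hx.1]
      by_cases a1 : u ∈ S k <;> by_cases a2 : U ⊆ S k <;>
        simp [a1, a2, Finset.insert_subset_iff]

/-- **Theorem 8.** Let `l ≥ 1`, let `{m_k}` be an enumeration of `D(l)` and let
`T = {t_{n,k}}` be a summation method. If the sums `∑_k t_{n,k} a_k w_{m_k}(x)` converge to
zero as `n → ∞` on a measurable set `E ⊆ (0,1)` of measure `|E| > 1 - 2^{-l}`, then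
`a_k = 0` for all `k`. -/
theorem statement13 (l : ℕ) (hl : 1 ≤ l)
    (m : ℕ → ℕ) (hminj : Function.Injective m) (hmr : Set.range m = DyadicSums l)
    (t : ℕ → ℕ → ℝ) (M : ℝ)
    (ht1 : ∀ i, (Function.support (t i)).Finite)
    (ht2 : ∀ i k, |t i k| ≤ M)
    (ht3 : ∀ k, Tendsto (fun i => t i k) atTop (𝓝 1))
    (a : ℕ → ℝ) (E : Set ℝ) (hE : MeasurableSet E) (hE1 : E ⊆ Set.Ioo 0 1)
    (hEm : ENNReal.ofReal (1 - 1 / 2 ^ l) < volume E)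
    (hz : ∀ x ∈ E, Tendsto (fun i => ∑ᶠ k, t i k * a k * walsh (m k) x) atTop (𝓝 0)) :
    ∀ k, a k = 0 := by
  intro k0
  set S : ℕ → Finset ℕ := fun k => bitSet (m k) with hS
  have hSd : ∀ k, (S k).card = l ∧ ∀ j ∈ S k, 1 ≤ j := fun k =>
    bitSet_dyadic (hmr ▸ Set.mem_range_self k)
  have hz' : ∀ x ∈ nonDyadic ∩ Set.Ioo 0 1, x ∉ Set.Ioo 0 1 \ E →
      Tendsto (fun i => ∑ k ∈ (ht1 i).toFinset, (t i k * a k) * ∏ j ∈ S k, rademacher j x)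
        atTop (𝓝 0) := by
    intro x hx hxB
    have hxE : x ∈ E := by
      by_contra h
      exact hxB ⟨hx.2, h⟩
    refine (hz x hxE).congr (fun i => ?_)
    rw [finsum_eq_sum_of_support_subset (s := (ht1 i).toFinset)]
    · exact Finset.sum_congr rfl (fun k _ => by rw [walsh_eq])
    · intro k hk
      simp only [Set.Finite.coe_toFinset, Function.mem_support] at hk ⊢
      intro h
      simp [h] at hk
  obtain ⟨B', hB', hv, h⟩ := main_induction S (fun i k => t i k * a k)
    (fun i => (ht1 i).toFinset) (Set.Ioo 0 1 \ E) (measurableSet_Ioo.diff hE) hz' (S k0) (hSd k0).2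
  have hlt : volume B' < 1 := by
    refine lt_of_le_of_lt hv ?_
    have hEle : volume E ≤ 1 := by
      calc volume E ≤ volume (Set.Ioo (0 : ℝ) 1) := measure_mono hE1
        _ = 1 := by simp
    have hEfin : volume E ≠ ⊤ := ne_top_of_le_ne_top ENNReal.one_ne_top hEle
    rw [measure_sdiff hE1 hE.nullMeasurableSet hEfin, (hSd k0).1, Real.volume_Ioo, sub_zero,
      ENNReal.ofReal_one]
    have hr : 1 - 1 / 2 ^ l < (volume E).toReal :=
      (ENNReal.ofReal_lt_iff_lt_toReal (by
        rw [sub_nonneg, div_le_one (by positivity)]; exact one_le_pow₀ (by norm_num)) hEfin).1 hEm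
    have e : (2 : ENNReal) ^ l * (1 - volume E) =
        ENNReal.ofReal (2 ^ l * (1 - (volume E).toReal)) := by
      rw [ENNReal.ofReal_mul (by positivity), ENNReal.ofReal_sub _ ENNReal.toReal_nonneg,
        ENNReal.ofReal_toReal hEfin, ENNReal.ofReal_pow (by norm_num)]
      simp
    rw [e, ENNReal.ofReal_lt_one]
    have hp : (0 : ℝ) < 2 ^ l := by positivity
    have h3 : (2 : ℝ) ^ l * (1 / 2 ^ l) = 1 := by field_simp
    nlinarith
  obtain ⟨x, hx, hxB⟩ : ∃ x ∈ nonDyadic ∩ Set.Ioo (0 : ℝ) 1, x ∉ B' := by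
    by_contra! hcon
    have hsub : Set.Ioo (0 : ℝ) 1 ⊆ nonDyadicᶜ ∪ B' := by
      intro x hx
      by_cases hd : x ∈ nonDyadic
      · exact Or.inr (hcon x ⟨hd, hx⟩)
      · exact Or.inl hd
    have h1 := (measure_mono hsub).trans (measure_union_le (μ := volume) _ _)
    rw [ae_nonDyadic, zero_add, Real.volume_Ioo, sub_zero, ENNReal.ofReal_one] at h1
    exact absurd hlt (not_lt.2 h1)
  have hlim := h x hx hxB
  have hlim2 : Tendsto (fun i => t i k0 * (a k0 * ∏ j ∈ S k0, rademacher j x)) atTop (𝓝 0) := by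
    refine hlim.congr (fun i => ?_)
    rw [Finset.sum_eq_single k0]
    · simp [mul_assoc]
    · intro k _ hk
      rw [if_neg]
      intro hsub
      have := Finset.eq_of_subset_of_card_le hsub (by rw [(hSd k).1, (hSd k0).1])
      exact hk (hminj (bitSet_inj this.symm))
    · intro hk
      simp only [Set.Finite.mem_toFinset, Function.mem_support, not_not] at hk
      simp [hk]
  have hlim3 := (ht3 k0).mul_const (a k0 * ∏ j ∈ S k0, rademacher j x)
  have h0 := tendsto_nhds_unique hlim3 hlim2
  rw [one_mul, mul_eq_zero] at h0
  refine h0.resolve_right (Finset.prod_ne_zero_iff.2 (fun j _ => ?_))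
  rcases rad_pm hx.1 j with ⟨h, -⟩ | ⟨h, -⟩ <;> rw [h] <;> norm_num
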